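/- Fix finite state and action sets S, A, transition probabilities T, a discount γ ∈ (0,1), a start state s0, and a state-reward function R : S → ℝ with |R(s)| ≤ RMax for all s. For a stochastic stationary policy π define the normalized discounted value V^π(s0) = Σ_{s∈S} ρ_{π,s0}(s)·R(s) = (1−γ)·Σ_{t≥0} γ^t Σ_s ρ^t_{π,s0}(s)·R(s). If π1 and π2 satisfy sup_{s∈S} Σ_{a∈A} |π1(a|s) − π2(a|s)| ≤ Δ, then |V^{π1}(s0) − V^{π2}(s0)| ≤ Δ·γ·RMax/(1−γ). -/

import Mathlib

open Finset

/-- The `t`-step state distribution of a stochastic stationary policy `π` started at `s0`: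
`ρ⁰ = δ_{s0}` and `ρ^{t+1}(s') = Σ_s ρ^t(s) Σ_a π(a|s) T(s'|s,a)`. -/
noncomputable def stepDist {S A : Type} [Fintype S] [Fintype A] [DecidableEq S]
    (T : S → A → S → ℝ) (π : S → A → ℝ) (s0 : S) : ℕ → S → ℝ
  | 0 => fun s => if s = s0 then 1 else 0
  | t + 1 => fun s' => ∑ s, stepDist T π s0 t s * ∑ a, π s a * T s a s'

/-- A kernel whose rows have `ℓ¹` norm at most `c` maps `f` to a vector of `ℓ¹` norm at most
`c * ‖f‖₁`. -/
theorem sum_abs_sum_mul_le {ι κ : Type*} [Fintype ι] [Fintype κ] (f : ι → ℝ) (K : ι → κ → ℝ)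
    {c : ℝ} (hK : ∀ i, ∑ j, |K i j| ≤ c) :
    ∑ j, |∑ i, f i * K i j| ≤ c * ∑ i, |f i| :=
  calc ∑ j, |∑ i, f i * K i j| ≤ ∑ j, ∑ i, |f i| * |K i j| := by
        refine sum_le_sum fun j _ => (abs_sum_le_sum_abs _ _).trans_eq ?_
        simp only [abs_mul]
    _ = ∑ i, |f i| * ∑ j, |K i j| := by
        rw [sum_comm]
        simp only [mul_sum]
    _ ≤ ∑ i, |f i| * c :=
        sum_le_sum fun i _ => mul_le_mul_of_nonneg_left (hK i) (abs_nonneg _)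
    _ = c * ∑ i, |f i| := by rw [← sum_mul, mul_comm]

/-- Pairing with a function bounded by `M` is bounded by `M` times the `ℓ¹` norm. -/
theorem abs_sum_mul_le {ι : Type*} [Fintype ι] (f g : ι → ℝ) {M : ℝ} (hg : ∀ i, |g i| ≤ M) :
    |∑ i, f i * g i| ≤ M * ∑ i, |f i| := by
  simpa using sum_abs_sum_mul_le f (fun i (_ : Unit) => g i) (by simpa using hg)

section stepDist

variable {S A : Type} [Fintype S] [Fintype A] [DecidableEq S] {T : S → A → S → ℝ}

theorem sum_abs_stepDist_le_one (hT : ∀ s a, ∑ s', |T s a s'| ≤ 1) {π : S → A → ℝ}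
    (hπ : ∀ s, ∑ a, |π s a| ≤ 1) (s0 : S) (t : ℕ) : ∑ s, |stepDist T π s0 t s| ≤ 1 := by
  induction t with
  | zero => simp [stepDist, apply_ite abs]
  | succ t ih =>
    refine (sum_abs_sum_mul_le (stepDist T π s0 t) _ fun s => ?_).trans ((one_mul _).trans_le ih)
    exact (sum_abs_sum_mul_le (π s) _ (hT s)).trans ((one_mul _).trans_le (hπ s))

theorem sum_abs_stepDist_sub_le (hT : ∀ s a, ∑ s', |T s a s'| ≤ 1) {π₁ π₂ : S → A → ℝ}
    (hπ₁ : ∀ s, ∑ a, |π₁ s a| ≤ 1) (hπ₂ : ∀ s, ∑ a, |π₂ s a| ≤ 1) {Δ : ℝ} (hΔ0 : 0 ≤ Δ)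
    (hΔ : ∀ s, ∑ a, |π₁ s a - π₂ s a| ≤ Δ) (s0 : S) (t : ℕ) :
    ∑ s, |stepDist T π₁ s0 t s - stepDist T π₂ s0 t s| ≤ t * Δ := by
  induction t with
  | zero => simp [stepDist]
  | succ t ih =>
    have hsplit : ∀ s', stepDist T π₁ s0 (t + 1) s' - stepDist T π₂ s0 (t + 1) s' =
        (∑ s, (stepDist T π₁ s0 t s - stepDist T π₂ s0 t s) * ∑ a, π₁ s a * T s a s') +
          ∑ s, stepDist T π₂ s0 t s * ∑ a, (π₁ s a - π₂ s a) * T s a s' := by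
      intro s'
      simp only [stepDist, sub_mul, sum_sub_distrib, mul_sub]
      ring
    have h₁ : ∑ s', |∑ s, (stepDist T π₁ s0 t s - stepDist T π₂ s0 t s) *
        ∑ a, π₁ s a * T s a s'| ≤ 1 * (t * Δ) :=
      (sum_abs_sum_mul_le _ _ fun s => (sum_abs_sum_mul_le (π₁ s) _ (hT s)).trans
        ((one_mul _).trans_le (hπ₁ s))).trans (mul_le_mul_of_nonneg_left ih zero_le_one)
    have h₂ : ∑ s', |∑ s, stepDist T π₂ s0 t s * ∑ a, (π₁ s a - π₂ s a) * T s a s'| ≤ Δ * 1 :=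
      (sum_abs_sum_mul_le _ _ fun s =>
        (sum_abs_sum_mul_le (fun a => π₁ s a - π₂ s a) _ (hT s)).trans
          ((one_mul _).trans_le (hΔ s))).trans
        (mul_le_mul_of_nonneg_left (sum_abs_stepDist_le_one hT hπ₂ s0 t) hΔ0)
    calc _ ≤ 1 * (t * Δ) + Δ * 1 := by
          refine le_trans ?_ (add_le_add h₁ h₂)
          rw [← sum_add_distrib]
          exact sum_le_sum fun s' _ => (hsplit s').symm ▸ abs_add_le _ _
      _ = (t + 1 : ℕ) * Δ := by push_cast; ring

theorem summable_discounted_stepDist (hT : ∀ s a, ∑ s', |T s a s'| ≤ 1) {π : S → A → ℝ}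
    (hπ : ∀ s, ∑ a, |π s a| ≤ 1) {γ : ℝ} (hγ0 : 0 ≤ γ) (hγ1 : γ < 1) (s0 : S) {R : S → ℝ}
    {M : ℝ} (hR : ∀ s, |R s| ≤ M) :
    Summable fun t : ℕ => γ ^ t * ∑ s, stepDist T π s0 t s * R s := by
  have hM : 0 ≤ M := (abs_nonneg _).trans (hR s0)
  refine Summable.of_norm_bounded ((summable_geometric_of_lt_one hγ0 hγ1).mul_right M) fun t => ?_
  rw [Real.norm_eq_abs, abs_mul, abs_of_nonneg (pow_nonneg hγ0 t)]
  refine mul_le_mul_of_nonneg_left ((abs_sum_mul_le _ _ hR).trans ?_) (pow_nonneg hγ0 t)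
  exact mul_le_of_le_one_right hM (sum_abs_stepDist_le_one hT hπ s0 t)

end stepDist

/-- (Corollary of Lemma 5.3.)  If two stochastic stationary policies are
`Δ`-close in total policy deviation at every state, then their normalized discounted values
`V^π(s0) = (1-γ) Σ_t γ^t Σ_s ρ^t_{π,s0}(s) R(s)` differ by at most `Δ·γ·RMax/(1-γ)`. -/
theorem stmt_10
    {S A : Type} [Fintype S] [Fintype A] [Nonempty S] [Nonempty A] [DecidableEq S]
    (T : S → A → S → ℝ)
    (hT0 : ∀ s a s', 0 ≤ T s a s') (hT1 : ∀ s a, ∑ s', T s a s' = 1)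
    (γ : ℝ) (hγ0 : 0 < γ) (hγ1 : γ < 1)
    (s0 : S)
    (π₁ π₂ : S → A → ℝ)
    (hπ₁0 : ∀ s a, 0 ≤ π₁ s a) (hπ₁1 : ∀ s, ∑ a, π₁ s a = 1)
    (hπ₂0 : ∀ s a, 0 ≤ π₂ s a) (hπ₂1 : ∀ s, ∑ a, π₂ s a = 1)
    (Δ : ℝ) (hΔ0 : 0 ≤ Δ)
    (hΔ : ∀ s, ∑ a, |π₁ s a - π₂ s a| ≤ Δ)
    (Rw : S → ℝ) (RMax : ℝ) (hRw : ∀ s, |Rw s| ≤ RMax) :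
    |(1 - γ) * (∑' t : ℕ, γ ^ t * ∑ s, stepDist T π₁ s0 t s * Rw s) -
     (1 - γ) * (∑' t : ℕ, γ ^ t * ∑ s, stepDist T π₂ s0 t s * Rw s)|
      ≤ Δ * γ * RMax / (1 - γ) := by
  have hT : ∀ s a, ∑ s', |T s a s'| ≤ 1 := fun s a => by
    simp only [abs_of_nonneg (hT0 s a _), hT1, le_refl]
  have hπ₁ : ∀ s, ∑ a, |π₁ s a| ≤ 1 := fun s => by
    simp only [abs_of_nonneg (hπ₁0 s _), hπ₁1, le_refl]
  have hπ₂ : ∀ s, ∑ a, |π₂ s a| ≤ 1 := fun s => by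
    simp only [abs_of_nonneg (hπ₂0 s _), hπ₂1, le_refl]
  have hM : 0 ≤ RMax := (abs_nonneg _).trans (hRw s0)
  have hγ : 0 < 1 - γ := sub_pos.2 hγ1
  have hsum := (hasSum_coe_mul_geometric_of_norm_lt_one
    (by rwa [Real.norm_eq_abs, abs_of_pos hγ0] : ‖γ‖ < 1)).mul_right (RMax * Δ)
  rw [← mul_sub, ← (summable_discounted_stepDist hT hπ₁ hγ0.le hγ1 s0 hRw).tsum_sub
    (summable_discounted_stepDist hT hπ₂ hγ0.le hγ1 s0 hRw), abs_mul, abs_of_pos hγ]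
  have hbound := tsum_of_norm_bounded
    (f := fun t : ℕ => γ ^ t * ∑ s, stepDist T π₁ s0 t s * Rw s -
      γ ^ t * ∑ s, stepDist T π₂ s0 t s * Rw s) hsum fun t => by
    rw [← mul_sub, ← sum_sub_distrib, Real.norm_eq_abs, abs_mul, abs_of_pos (pow_pos hγ0 t)]
    simp only [← sub_mul]
    calc _ ≤ γ ^ t * (RMax * (t * Δ)) := by
          refine mul_le_mul_of_nonneg_left ((abs_sum_mul_le _ _ hRw).trans ?_) (pow_pos hγ0 t).le
          exact mul_le_mul_of_nonneg_left
            (sum_abs_stepDist_sub_le hT hπ₁ hπ₂ hΔ0 hΔ s0 t) hM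
      _ = t * γ ^ t * (RMax * Δ) := by ring
  refine (mul_le_mul_of_nonneg_left hbound hγ.le).trans_eq ?_
  field_simp
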